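/- Let C₁ = K(x₁, r₁), C₂ = K(x₂, r₂), C₃ = K(x₃, r₃) be circles with rᵢ > 0 such that C₂ and C₃ cross in two points, |r₂ − r₃| < ‖x₂ − x₃‖ < r₂ + r₃, while C₁ is externally disjoint from both: ‖x₁ − x₂‖ > r₁ + r₂ and ‖x₁ − x₃‖ > r₁ + r₃. Then the Apollonius problem for (C₁, C₂, C₃) has exactly 4 solutions. -/

import Mathlib

open RealInnerProductSpace

noncomputable section

/-- The Euclidean plane. -/
abbrev Pl := EuclideanSpace ℝ (Fin 2)

/-- The circle of center `x` and radius `r` in the Euclidean plane. -/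
def K (x : Pl) (r : ℝ) : Set Pl := {p | dist p x = r}

/-- Two circles, given by centers and (positive) radii, are tangent. -/
def CircleTangent (y : Pl) (s : ℝ) (x : Pl) (r : ℝ) : Prop :=
  dist y x = s + r ∨ dist y x = |s - r|

/-- A line (a 1-dimensional affine subspace of the plane) is tangent to a circle iff it
meets it in exactly one point. -/
def LineTangent (L : AffineSubspace ℝ Pl) (x : Pl) (r : ℝ) : Prop :=
  ∃! p, p ∈ (L : Set Pl) ∩ K x r

/-- Solutions of the Apollonius problem for three circles with centers `x i` and radii
`r i`: a solution is either a circle `(y, s)` with `s > 0` tangent to all three, or a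
line (1-dimensional affine subspace) tangent to all three, or a point lying on all
three. The solution set is the disjoint union (sum type) of these three sets. -/
def ApolloniusSolutions (x : Fin 3 → Pl) (r : Fin 3 → ℝ) : Type :=
  {ys : Pl × ℝ // 0 < ys.2 ∧ ∀ i, CircleTangent ys.1 ys.2 (x i) (r i)} ⊕
  {L : AffineSubspace ℝ Pl // Module.finrank ℝ L.direction = 1 ∧
    ∀ i, LineTangent L (x i) (r i)} ⊕
  {p : Pl // ∀ i, p ∈ K (x i) (r i)}


/-- auxiliary parametrisation of solutions -/
def TS (a0 a1 b0 b1 r1 r2 r3 : ℝ) : Set (ℝ × ℝ × ℝ × ℝ) :=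
  {t | (t.1 = 1 ∨ t.1 = -1) ∧ t.2.1 ^ 2 + t.2.2.1 ^ 2 = 1 ∧
    2 * (t.2.1 * a0 + t.2.2.1 * a1 - (t.1 * r2 - r1)) =
      (a0 ^ 2 + a1 ^ 2 - (t.1 * r2 - r1) ^ 2) * t.2.2.2 ∧
    2 * (t.2.1 * b0 + t.2.2.1 * b1 - (t.1 * r3 - r1)) =
      (b0 ^ 2 + b1 ^ 2 - (t.1 * r3 - r1) ^ 2) * t.2.2.2}

lemma two_sol (a0 a1 b0 b1 α β A B : ℝ) (hA : A = a0 ^ 2 + a1 ^ 2 - α ^ 2)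
    (hB : B = b0 ^ 2 + b1 ^ 2 - β ^ 2) (pA : 0 < A) (pB : 0 < B)
    (pD : 0 < (a0 - b0) ^ 2 + (a1 - b1) ^ 2 - (α - β) ^ 2) :
    ∃ p q : ℝ × ℝ × ℝ, p ≠ q ∧ ∀ t : ℝ × ℝ × ℝ, (t.1 ^ 2 + t.2.1 ^ 2 = 1 ∧
      2 * (t.1 * a0 + t.2.1 * a1 - α) = A * t.2.2 ∧
      2 * (t.1 * b0 + t.2.1 * b1 - β) = B * t.2.2) ↔ t = p ∨ t = q := by
  obtain ⟨m, hm⟩ : ∃ m, m = B * a0 - A * b0 := ⟨_, rfl⟩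
  obtain ⟨n, hn⟩ : ∃ n, n = B * a1 - A * b1 := ⟨_, rfl⟩
  obtain ⟨k, hk⟩ : ∃ k, k = B * α - A * β := ⟨_, rfl⟩
  have key : 0 < m ^ 2 + n ^ 2 - k ^ 2 := by
    have : m ^ 2 + n ^ 2 - k ^ 2 =
        A * B * ((a0 - b0) ^ 2 + (a1 - b1) ^ 2 - (α - β) ^ 2) := by
      subst hm hn hk
      have e1 : a0 ^ 2 = A + α ^ 2 - a1 ^ 2 := by linarith
      have e2 : b0 ^ 2 = B + β ^ 2 - b1 ^ 2 := by linarith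
      linear_combination (B ^ 2 - A * B) * e1 + (A ^ 2 - A * B) * e2
    rw [this]; positivity
  obtain ⟨h, hpos, hh⟩ : ∃ h, 0 < h ∧ h ^ 2 = m ^ 2 + n ^ 2 - k ^ 2 :=
    ⟨Real.sqrt _, Real.sqrt_pos.2 key, Real.sq_sqrt key.le⟩
  obtain ⟨N, hN⟩ : ∃ N, N = m ^ 2 + n ^ 2 := ⟨_, rfl⟩
  have pN : 0 < N := by nlinarith [sq_nonneg k]
  have hN0 := pN.ne'
  have hA0 := pA.ne'
  have hB0 := pB.ne'
  let f : ℝ → ℝ × ℝ × ℝ := fun e => ((k * m - e * n) / N, (k * n + e * m) / N,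
    2 * ((k * m - e * n) / N * a0 + (k * n + e * m) / N * a1 - α) / A)
  have hf : ∀ e, e ^ 2 = h ^ 2 → ((f e).1 ^ 2 + (f e).2.1 ^ 2 = 1 ∧
      2 * ((f e).1 * a0 + (f e).2.1 * a1 - α) = A * (f e).2.2 ∧
      2 * ((f e).1 * b0 + (f e).2.1 * b1 - β) = B * (f e).2.2) := by
    intro e he
    simp only [f]
    have hmn : (k * m - e * n) / N * m + (k * n + e * m) / N * n = k := by
      field_simp; rw [hN]; ring
    refine ⟨?_, ?_, ?_⟩
    · field_simp
      rw [hN]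
      linear_combination (m ^ 2 + n ^ 2) * he + (m ^ 2 + n ^ 2) * hh
    · field_simp
    · generalize (k * m - e * n) / N = u at *
      generalize (k * n + e * m) / N = v at *
      rw [hm, hn, hk] at hmn
      field_simp
      linear_combination (-1) * hmn
  refine ⟨f h, f (-h), ?_, ?_⟩
  · intro heq
    have e1 : (k * m - h * n) / N = (k * m - (-h) * n) / N := congrArg (fun t => t.1) heq
    have e2 : (k * n + h * m) / N = (k * n + (-h) * m) / N := congrArg (fun t => t.2.1) heq
    field_simp at e1 e2
    have z1 : n = 0 := by
      have : h * n = 0 := by linarith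
      rcases mul_eq_zero.1 this with h0 | h0
      · exact absurd h0 hpos.ne'
      · exact h0
    have z2 : m = 0 := by
      have : h * m = 0 := by linarith
      rcases mul_eq_zero.1 this with h0 | h0
      · exact absurd h0 hpos.ne'
      · exact h0
    rw [z1, z2] at hN
    simp at hN
    exact hN0 hN
  · rintro ⟨u, v, w⟩
    constructor
    · rintro ⟨g1, g2, g3⟩
      simp only at g1 g2 g3
      have g4 : u * m + v * n = k := by
        rw [hm, hn, hk]
        linear_combination (B / 2) * g2 - (A / 2) * g3
      obtain ⟨e, he⟩ : ∃ e, e = v * m - u * n := ⟨_, rfl⟩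
      have he2 : e ^ 2 = h ^ 2 := by
        rw [he, hh, ← g4]
        linear_combination (m ^ 2 + n ^ 2) * g1
      have hu : (k * m - e * n) / N = u := by
        rw [he, ← g4, hN]; rw [hN] at hN0; field_simp; ring
      have hv : (k * n + e * m) / N = v := by
        rw [he, ← g4, hN]; rw [hN] at hN0; field_simp; ring
      have : (u, v, w) = f e := by
        simp only [f, hu, hv]
        rw [g2]; field_simp
      rcases sq_eq_sq_iff_eq_or_eq_neg.1 he2 with h' | h'
      · left; rw [this, h']
      · right; rw [this, h']
    · rintro (h' | h')
      · rw [h']; exact hf h rfl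
      · rw [h']; exact hf (-h) (by ring)

lemma TS_card (a0 a1 b0 b1 r1 r2 r3 : ℝ) (h₁ : 0 < r1) (h₂ : 0 < r2) (h₃ : 0 < r3)
    (ha : (r1 + r2) ^ 2 < a0 ^ 2 + a1 ^ 2) (hb : (r1 + r3) ^ 2 < b0 ^ 2 + b1 ^ 2)
    (hab : (r2 - r3) ^ 2 < (a0 - b0) ^ 2 + (a1 - b1) ^ 2) :
    (TS a0 a1 b0 b1 r1 r2 r3).ncard = 4 := by
  have q2 := mul_pos h₁ h₂
  have q3 := mul_pos h₁ h₃
  obtain ⟨p, q, hpq, H⟩ := two_sol a0 a1 b0 b1 (1 * r2 - r1) (1 * r3 - r1) _ _ rfl rfl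
    (by nlinarith) (by nlinarith) (by nlinarith)
  obtain ⟨p', q', hpq', H'⟩ := two_sol a0 a1 b0 b1 (-1 * r2 - r1) (-1 * r3 - r1) _ _ rfl rfl
    (by nlinarith) (by nlinarith) (by nlinarith)
  have : TS a0 a1 b0 b1 r1 r2 r3 = {(1, p), (1, q), (-1, p'), (-1, q')} := by
    ext ⟨d, t⟩
    simp only [TS, Set.mem_ofPred_eq, Set.mem_insert_iff, Set.mem_singleton_iff, Prod.mk.injEq]
    constructor
    · rintro ⟨rfl | rfl, h⟩
      · rcases (H t).1 h with h | h <;> simp [h]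
      · rcases (H' t).1 h with h | h <;> simp [h]
    · rintro (⟨rfl, h⟩ | ⟨rfl, h⟩ | ⟨rfl, h⟩ | ⟨rfl, h⟩)
      · exact ⟨Or.inl rfl, (H t).2 (Or.inl h)⟩
      · exact ⟨Or.inl rfl, (H t).2 (Or.inr h)⟩
      · exact ⟨Or.inr rfl, (H' t).2 (Or.inl h)⟩
      · exact ⟨Or.inr rfl, (H' t).2 (Or.inr h)⟩
  rw [this]
  have c1 : (1:ℝ) ≠ -1 := by norm_num
  rw [Set.ncard_insert_of_notMem, Set.ncard_insert_of_notMem, Set.ncard_pair]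
  · simpa using hpq'
  · simp [c1]
  · simp [c1, hpq]

lemma dist_sq_coord (p q : Pl) : dist p q ^ 2 = (p 0 - q 0) ^ 2 + (p 1 - q 1) ^ 2 := by
  rw [EuclideanSpace.dist_eq, Real.sq_sqrt (by positivity)]
  simp [Fin.sum_univ_two, Real.dist_eq, sq_abs]

lemma dist_eq_iff_sq (p q : Pl) (r : ℝ) (hr : 0 ≤ r) :
    dist p q = r ↔ (p 0 - q 0) ^ 2 + (p 1 - q 1) ^ 2 = r ^ 2 := by
  rw [← dist_sq_coord, sq_eq_sq₀ dist_nonneg hr]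

lemma pl_ext {p q : Pl} (h0 : p 0 = q 0) (h1 : p 1 = q 1) : p = q := by
  ext i; fin_cases i <;> assumption

lemma circleTangent_iff (y x : Pl) (s r : ℝ) (hs : 0 ≤ s) (hr : 0 ≤ r) :
    CircleTangent y s x r ↔ ∃ e : ℝ, (e = 1 ∨ e = -1) ∧
      (y 0 - x 0) ^ 2 + (y 1 - x 1) ^ 2 = (s - e * r) ^ 2 := by
  unfold CircleTangent
  rw [dist_eq_iff_sq _ _ _ (by positivity), dist_eq_iff_sq _ _ _ (by positivity), sq_abs]
  constructor
  · rintro (h | h)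
    · exact ⟨-1, Or.inr rfl, by rw [h]; ring⟩
    · exact ⟨1, Or.inl rfl, by rw [h]; ring⟩
  · rintro ⟨e, rfl | rfl, h⟩
    · right; rw [h]; ring
    · left; rw [h]; ring

/-- the line `u · q = c`, `u` a unit vector -/
def ln (u0 u1 c : ℝ) : AffineSubspace ℝ Pl :=
  AffineSubspace.mk' (!₂[c * u0, c * u1] : Pl) (Submodule.span ℝ {(!₂[-u1, u0] : Pl)})

lemma mem_ln (u0 u1 c : ℝ) (hu : u0 ^ 2 + u1 ^ 2 = 1) (q : Pl) :
    q ∈ ln u0 u1 c ↔ u0 * q 0 + u1 * q 1 = c := by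
  unfold ln
  rw [AffineSubspace.mem_mk', Submodule.mem_span_singleton]
  constructor
  · rintro ⟨t, ht⟩
    have e0 := congrArg (fun v : Pl => v 0) ht
    have e1 := congrArg (fun v : Pl => v 1) ht
    simp at e0 e1
    linear_combination (-u0) * e0 - u1 * e1 + c * hu
  · intro h
    refine ⟨u0 * q 1 - u1 * q 0, pl_ext ?_ ?_⟩
    · simp
      linear_combination (-u0) * h + q 0 * hu
    · simp
      linear_combination (-u1) * h + q 1 * hu

lemma finrank_ln (u0 u1 c : ℝ) (hu : u0 ^ 2 + u1 ^ 2 = 1) :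
    Module.finrank ℝ (ln u0 u1 c).direction = 1 := by
  unfold ln
  rw [AffineSubspace.direction_mk']
  apply finrank_span_singleton
  intro h
  have e0 := congrArg (fun v : Pl => v 0) h
  have e1 := congrArg (fun v : Pl => v 1) h
  simp at e0 e1
  simp [e0, e1] at hu

lemma ln_tangent (u0 u1 c : ℝ) (hu : u0 ^ 2 + u1 ^ 2 = 1) (x : Pl) (r : ℝ) (hr : 0 < r) :
    LineTangent (ln u0 u1 c) x r ↔ (u0 * x 0 + u1 * x 1 - c) ^ 2 = r ^ 2 := by
  unfold LineTangent K
  simp only [Set.mem_inter_iff, SetLike.mem_coe, mem_ln u0 u1 c hu, Set.mem_ofPred_eq,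
    dist_eq_iff_sq _ _ _ hr.le]
  constructor
  · rintro ⟨p, ⟨hp, hd⟩, huniq⟩
    obtain ⟨t, ht⟩ : ∃ t, t = (p 0 - x 0) * (-u1) + (p 1 - x 1) * u0 := ⟨_, rfl⟩
    have := huniq (!₂[p 0 + 2 * t * u1, p 1 - 2 * t * u0]) ⟨by simp; linarith, by
      simp
      linear_combination hd + 4 * t ^ 2 * hu + 4 * t * ht⟩
    have e0 := congrArg (fun v : Pl => v 0) this
    have e1 := congrArg (fun v : Pl => v 1) this
    simp at e0 e1
    have t0 : t = 0 := by
      rcases e0 with h | h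
      · exact h
      rcases e1 with h' | h'
      · exact h'
      simp [h, h'] at hu
    rw [t0] at ht
    rw [← hp, ← hd]
    linear_combination ((p 0 - x 0) ^ 2 + (p 1 - x 1) ^ 2) * hu
      + ((p 0 - x 0) * (-u1) + (p 1 - x 1) * u0) * ht
  · intro h
    obtain ⟨k, hk⟩ : ∃ k, k = c - (u0 * x 0 + u1 * x 1) := ⟨_, rfl⟩
    have hk2 : k ^ 2 = r ^ 2 := by rw [← h, hk]; ring
    refine ⟨!₂[x 0 + k * u0, x 1 + k * u1], ⟨?_, ?_⟩, ?_⟩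
    · simp
      linear_combination k * hu + hk
    · simp
      linear_combination k ^ 2 * hu + hk2
    · rintro q ⟨h1, h2⟩
      have hz : (q 0 - x 0 - k * u0) ^ 2 + (q 1 - x 1 - k * u1) ^ 2 = 0 := by
        linear_combination h2 - hk2 + k ^ 2 * hu - 2 * k * h1 + 2 * k * hk
      have z0 : q 0 - x 0 - k * u0 = 0 := by
        nlinarith [sq_nonneg (q 0 - x 0 - k * u0), sq_nonneg (q 1 - x 1 - k * u1)]
      have z1 : q 1 - x 1 - k * u1 = 0 := by
        nlinarith [sq_nonneg (q 0 - x 0 - k * u0), sq_nonneg (q 1 - x 1 - k * u1)]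
      apply pl_ext
      · simp; linarith
      · simp; linarith

lemma line_form (L : AffineSubspace ℝ Pl) (hL : Module.finrank ℝ L.direction = 1) (x : Pl) :
    ∀ r : ℝ, 0 < r → LineTangent L x r →
    ∃ u0 u1, u0 ^ 2 + u1 ^ 2 = 1 ∧ L = ln u0 u1 (u0 * x 0 + u1 * x 1 - r) := by
  intro r hr hT
  obtain ⟨v, hv0, hv⟩ := finrank_eq_one_iff'.1 hL
  have hT' := hT
  obtain ⟨p, ⟨hpL, hpK⟩, -⟩ := hT'
  obtain ⟨N, hN0, hN⟩ : ∃ N : ℝ, 0 < N ∧ N ^ 2 = v.1 0 ^ 2 + v.1 1 ^ 2 := by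
    have : 0 < v.1 0 ^ 2 + v.1 1 ^ 2 := by
      by_contra hcon
      apply hv0
      apply Subtype.ext
      apply pl_ext
      · simp; nlinarith [sq_nonneg (v.1 0), sq_nonneg (v.1 1)]
      · simp; nlinarith [sq_nonneg (v.1 0), sq_nonneg (v.1 1)]
    exact ⟨Real.sqrt _, Real.sqrt_pos.2 this, Real.sq_sqrt this.le⟩
  obtain ⟨a, ha⟩ : ∃ a, a = v.1 1 / N := ⟨_, rfl⟩
  obtain ⟨b, hb⟩ : ∃ b, b = - v.1 0 / N := ⟨_, rfl⟩
  have hab : a ^ 2 + b ^ 2 = 1 := by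
    rw [ha, hb]; field_simp; linarith
  have ha' : v.1 1 = a * N := by rw [ha]; field_simp
  have hb' : v.1 0 = - b * N := by rw [hb]; field_simp
  have hLl : L = ln a b (a * p 0 + b * p 1) := by
    ext q
    rw [mem_ln _ _ _ hab, ← AffineSubspace.vsub_right_mem_direction_iff_mem hpL]
    constructor
    · intro hq
      obtain ⟨c, hc⟩ := hv ⟨_, hq⟩
      have hc' : c • v.1 = q -ᵥ p := congrArg Subtype.val hc
      have e0 := congrArg (fun v : Pl => v 0) hc'
      have e1 := congrArg (fun v : Pl => v 1) hc'
      simp [ha', hb'] at e0 e1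
      linear_combination (-a) * e0 - b * e1
    · intro hq
      have : q -ᵥ p = (((q 1 - p 1) * a - (q 0 - p 0) * b) / N) • v.1 := by
        apply pl_ext
        · simp [hb']; field_simp
          linear_combination a * hq - (q 0 - p 0) * hab
        · simp [ha']; field_simp
          linear_combination b * hq - (q 1 - p 1) * hab
      rw [this]
      exact Submodule.smul_mem _ _ v.2
  have hd := hT
  rw [hLl, ln_tangent _ _ _ hab _ _ hr] at hd
  rcases sq_eq_sq_iff_eq_or_eq_neg.1 hd with h | h
  · exact ⟨a, b, hab, by rw [hLl]; congr 1; linarith⟩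
  · refine ⟨-a, -b, by linarith, ?_⟩
    have hab' : (-a) ^ 2 + (-b) ^ 2 = 1 := by linarith
    rw [hLl]
    ext q
    rw [mem_ln _ _ _ hab, mem_ln _ _ _ hab']
    constructor <;> intro hq <;> linarith

lemma line_inj (x : Pl) (r u0 u1 v0 v1 : ℝ) (hr : 0 < r) (hu : u0 ^ 2 + u1 ^ 2 = 1)
    (hv : v0 ^ 2 + v1 ^ 2 = 1)
    (h : ln u0 u1 (u0 * x 0 + u1 * x 1 - r) = ln v0 v1 (v0 * x 0 + v1 * x 1 - r)) :
    u0 = v0 ∧ u1 = v1 := by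
  have m1 : (!₂[x 0 - r * u0, x 1 - r * u1] : Pl) ∈ ln u0 u1 (u0 * x 0 + u1 * x 1 - r) := by
    rw [mem_ln _ _ _ hu]
    simp
    linear_combination (-r) * hu
  rw [h, mem_ln _ _ _ hv] at m1
  simp at m1
  have m2 : u0 * v0 + u1 * v1 = 1 := by
    have : r * (u0 * v0 + u1 * v1 - 1) = 0 := by linarith
    rcases mul_eq_zero.1 this with h | h <;> linarith
  have hz : (u0 - v0) ^ 2 + (u1 - v1) ^ 2 = 0 := by
    linear_combination hu + hv - 2 * m2
  constructor
  · nlinarith [sq_nonneg (u0 - v0), sq_nonneg (u1 - v1)]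
  · nlinarith [sq_nonneg (u0 - v0), sq_nonneg (u1 - v1)]

lemma no_mixed (x₁ x₂ x₃ y : Pl) (r₁ r₂ r₃ s : ℝ)
    (h₁ : 0 < r₁) (hs : 0 < s)
    (h₂₃ : dist x₂ x₃ < r₂ + r₃) (h₁₃ : dist x₁ x₃ > r₁ + r₃)
    (t1 : CircleTangent y s x₁ r₁) (t2 : dist y x₂ = s + r₂) (t3 : dist y x₃ = |s - r₃|) :
    False := by
  have d1 : dist y x₁ ≤ s + r₁ := by
    rcases t1 with h | h
    · exact h.le
    · rw [h, abs_le]; constructor <;> linarith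
  have k1 := dist_triangle y x₃ x₂
  have k2 := dist_triangle x₁ y x₃
  rw [dist_comm x₃ x₂] at k1
  rw [dist_comm x₁ y] at k2
  rcases abs_cases (s - r₃) with ⟨h, _⟩ | ⟨h, _⟩ <;> linarith
set_option maxHeartbeats 1000000

lemma TS_mem (a0 a1 b0 b1 r1 r2 r3 d u v w : ℝ) :
    (d, u, v, w) ∈ TS a0 a1 b0 b1 r1 r2 r3 ↔ (d = 1 ∨ d = -1) ∧ u ^ 2 + v ^ 2 = 1 ∧
    2 * (u * a0 + v * a1 - (d * r2 - r1)) = (a0 ^ 2 + a1 ^ 2 - (d * r2 - r1) ^ 2) * w ∧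
    2 * (u * b0 + v * b1 - (d * r3 - r1)) = (b0 ^ 2 + b1 ^ 2 - (d * r3 - r1) ^ 2) * w :=
  Iff.rfl

/-- the circle of a parameter -/
def cm (x : Pl) (r : ℝ) (t : ℝ × ℝ × ℝ × ℝ) : Pl × ℝ :=
  (!₂[x 0 + t.2.1 / t.2.2.2, x 1 + t.2.2.1 / t.2.2.2], |r + 1 / t.2.2.2|)

/-- the line of a parameter -/
def lm (x : Pl) (r : ℝ) (t : ℝ × ℝ × ℝ × ℝ) : AffineSubspace ℝ Pl :=
  ln t.2.1 t.2.2.1 (t.2.1 * x 0 + t.2.2.1 * x 1 - r)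

/-- the parameter set of three circles -/
def TX (x₁ x₂ x₃ : Pl) (r₁ r₂ r₃ : ℝ) : Set (ℝ × ℝ × ℝ × ℝ) :=
  TS (x₂ 0 - x₁ 0) (x₂ 1 - x₁ 1) (x₃ 0 - x₁ 0) (x₃ 1 - x₁ 1) r₁ r₂ r₃

lemma sgn_unique {s r d e : ℝ} (hs : s ≠ 0) (hr : 0 < r) (h : (s - d * r) ^ 2 = (s - e * r) ^ 2)
    (hd : d = 1 ∨ d = -1) (he : e = 1 ∨ e = -1) : d = e := by
  have : s * r ≠ 0 := mul_ne_zero hs hr.ne'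
  rcases hd with rfl | rfl <;> rcases he with rfl | rfl
  · rfl
  · exact absurd (by linarith) this
  · exact absurd (by linarith) this
  · rfl

lemma circ_eqs (x₁ x₂ x₃ : Pl) (r₁ r₂ r₃ d u v w : ℝ)
    (ht : (d, u, v, w) ∈ TX x₁ x₂ x₃ r₁ r₂ r₃) (hw : w ≠ 0) :
    (x₁ 0 + u / w - x₁ 0) ^ 2 + (x₁ 1 + v / w - x₁ 1) ^ 2 = (r₁ + 1 / w - r₁) ^ 2 ∧
    (x₁ 0 + u / w - x₂ 0) ^ 2 + (x₁ 1 + v / w - x₂ 1) ^ 2 = (r₁ + 1 / w - d * r₂) ^ 2 ∧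
    (x₁ 0 + u / w - x₃ 0) ^ 2 + (x₁ 1 + v / w - x₃ 1) ^ 2 = (r₁ + 1 / w - d * r₃) ^ 2 := by
  obtain ⟨hd, hu, ha, hb⟩ := ht
  simp only at hd hu ha hb
  refine ⟨?_, ?_, ?_⟩
  · field_simp; linear_combination hu
  · field_simp
    linear_combination hu - w * ha
  · field_simp
    linear_combination hu - w * hb

lemma tangent_of_sgn (y x : Pl) (s r d : ℝ) (hr : 0 < r) (hd : d = 1 ∨ d = -1)
    (h : (y 0 - x 0) ^ 2 + (y 1 - x 1) ^ 2 = (s - d * r) ^ 2) : CircleTangent y |s| x r := by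
  rw [circleTangent_iff _ _ _ _ (abs_nonneg _) hr.le]
  rcases abs_cases s with ⟨e, _⟩ | ⟨e, _⟩ <;> rw [e]
  · exact ⟨d, hd, h⟩
  · refine ⟨-d, ?_, by rw [h]; ring⟩
    rcases hd with rfl | rfl <;> simp

lemma sig_ne (x₁ x₂ y : Pl) (r₁ r₂ d s : ℝ) (h₁ : 0 < r₁) (h₂ : 0 < r₂)
    (hd : d = 1 ∨ d = -1) (h₁₂ : dist x₁ x₂ > r₁ + r₂)
    (t1 : (y 0 - x₁ 0) ^ 2 + (y 1 - x₁ 1) ^ 2 = (s - r₁) ^ 2)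
    (t2 : (y 0 - x₂ 0) ^ 2 + (y 1 - x₂ 1) ^ 2 = (s - d * r₂) ^ 2) : s ≠ 0 := by
  rintro rfl
  have e1 : dist y x₁ = r₁ := by rw [dist_eq_iff_sq _ _ _ h₁.le, t1]; ring
  have e2 : dist y x₂ = r₂ := by
    rw [dist_eq_iff_sq _ _ _ h₂.le, t2]; rcases hd with rfl | rfl <;> ring
  have := dist_triangle x₁ y x₂
  rw [dist_comm x₁ y] at this
  linarith

lemma circles_eq (x₁ x₂ x₃ : Pl) (r₁ r₂ r₃ : ℝ)
    (h₁ : 0 < r₁) (h₂ : 0 < r₂) (h₃ : 0 < r₃)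
    (h₂₃ : dist x₂ x₃ < r₂ + r₃)
    (h₁₂ : dist x₁ x₂ > r₁ + r₂) (h₁₃ : dist x₁ x₃ > r₁ + r₃) :
    {ys : Pl × ℝ | 0 < ys.2 ∧ ∀ i, CircleTangent ys.1 ys.2 (![x₁, x₂, x₃] i) (![r₁, r₂, r₃] i)} =
    cm x₁ r₁ '' (TX x₁ x₂ x₃ r₁ r₂ r₃ ∩ {t | t.2.2.2 ≠ 0}) := by
  ext ⟨y, s⟩
  simp only [Set.mem_ofPred_eq, Fin.forall_fin_succ, Set.mem_image, Set.mem_inter_iff]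
  constructor
  · rintro ⟨hs, t1, t2, t3, -⟩
    simp at t1 t2 t3
    have q1 := t1
    rw [circleTangent_iff _ _ _ _ hs.le h₁.le] at q1
    obtain ⟨e1, he1, f1⟩ := q1
    obtain ⟨e, he, f2, f3⟩ : ∃ e : ℝ, (e = 1 ∨ e = -1) ∧
      (y 0 - x₂ 0) ^ 2 + (y 1 - x₂ 1) ^ 2 = (s - e * r₂) ^ 2 ∧
      (y 0 - x₃ 0) ^ 2 + (y 1 - x₃ 1) ^ 2 = (s - e * r₃) ^ 2 := by
      have D2 := dist_sq_coord y x₂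
      have D3 := dist_sq_coord y x₃
      rcases t2 with t2 | t2 <;> rcases t3 with t3 | t3
      · refine ⟨-1, Or.inr rfl, ?_, ?_⟩
        · rw [← D2, t2]; ring
        · rw [← D3, t3]; ring
      · exact (no_mixed x₁ x₂ x₃ y r₁ r₂ r₃ s h₁ hs h₂₃ h₁₃ t1 t2 t3).elim
      · rw [dist_comm x₂ x₃, add_comm r₂ r₃] at h₂₃
        exact (no_mixed x₁ x₃ x₂ y r₁ r₃ r₂ s h₁ hs h₂₃ h₁₂ t1 t3 t2).elim
      · refine ⟨1, Or.inl rfl, ?_, ?_⟩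
        · rw [← D2, t2, sq_abs]; ring
        · rw [← D3, t3, sq_abs]; ring
    have e1sq : e1 ^ 2 = 1 := by rcases he1 with rfl | rfl <;> norm_num
    have hd : e1 * e = 1 ∨ e1 * e = -1 := by
      rcases he1 with rfl | rfl <;> rcases he with rfl | rfl <;> simp
    obtain ⟨τ, hτ⟩ : ∃ τ, τ = e1 * s - r₁ := ⟨_, rfl⟩
    obtain ⟨d, hde⟩ : ∃ d, d = e1 * e := ⟨_, rfl⟩
    rw [← hde] at hd
    have g1 : (y 0 - x₁ 0) ^ 2 + (y 1 - x₁ 1) ^ 2 = τ ^ 2 := by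
      rw [f1, hτ]; linear_combination (r₁ ^ 2 - s ^ 2) * e1sq
    have g2 : (y 0 - x₂ 0) ^ 2 + (y 1 - x₂ 1) ^ 2 = (τ - (d * r₂ - r₁)) ^ 2 := by
      rw [f2, hτ, hde]; linear_combination (-(s - e * r₂) ^ 2) * e1sq
    have g3 : (y 0 - x₃ 0) ^ 2 + (y 1 - x₃ 1) ^ 2 = (τ - (d * r₃ - r₁)) ^ 2 := by
      rw [f3, hτ, hde]; linear_combination (-(s - e * r₃) ^ 2) * e1sq
    have hτ0 : τ ≠ 0 := by
      intro h0
      rw [h0] at g1 g2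
      have z0 : y 0 = x₁ 0 := by
        have : (y 0 - x₁ 0) ^ 2 = 0 := by
          linarith only [g1, sq_nonneg (y 0 - x₁ 0), sq_nonneg (y 1 - x₁ 1), sq_nonneg (y 0 - x₁ 0)]
        linarith only [pow_eq_zero_iff (two_ne_zero) |>.1 this]
      have z1 : y 1 = x₁ 1 := by
        have : (y 1 - x₁ 1) ^ 2 = 0 := by
          linarith only [g1, sq_nonneg (y 0 - x₁ 0), sq_nonneg (y 1 - x₁ 1), sq_nonneg (y 1 - x₁ 1)]
        linarith only [pow_eq_zero_iff (two_ne_zero) |>.1 this]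
      rw [z0, z1, ← dist_sq_coord] at g2
      have hp := mul_pos h₁ h₂
      have hl := pow_lt_pow_left₀ h₁₂ (by positivity) (two_ne_zero)
      rw [g2] at hl
      clear * - hl hp hd
      rcases hd with rfl | rfl <;> nlinarith only [hl, hp]
    refine ⟨(d, (y 0 - x₁ 0) / τ, (y 1 - x₁ 1) / τ, 1 / τ), ⟨⟨hd, ?_, ?_, ?_⟩, ?_⟩, ?_⟩
    · simp only; field_simp; linarith
    · simp only; field_simp; linear_combination g1 - g2
    · simp only; field_simp; linear_combination g1 - g3
    · simpa using hτ0
    · unfold cm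
      ext1
      · apply pl_ext
        · simp; field_simp; ring
        · simp; field_simp; ring
      · simp [hτ, abs_mul]
        rcases he1 with rfl | rfl <;> simp [abs_of_pos hs]
  · rintro ⟨⟨d, u, v, w⟩, ⟨ht, hw⟩, heq⟩
    simp only at hw
    obtain ⟨E1, E2, E3⟩ := circ_eqs _ _ _ _ _ _ _ _ _ _ ht hw
    have hd := ht.1
    simp only at hd
    unfold cm at heq
    simp only [Prod.mk.injEq] at heq
    obtain ⟨hy, hs⟩ := heq
    have y0 : y 0 = x₁ 0 + u / w := by rw [← hy]; simp
    have y1 : y 1 = x₁ 1 + v / w := by rw [← hy]; simp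
    rw [← y0, ← y1] at E1 E2 E3
    have hne := sig_ne x₁ x₂ y r₁ r₂ d _ h₁ h₂ hd h₁₂ E1 E2
    rw [← hs]
    refine ⟨abs_pos.2 hne, ?_, ?_, ?_, fun i => i.elim0⟩
    · exact tangent_of_sgn _ _ _ _ 1 h₁ (Or.inl rfl) (by simpa using E1)
    · exact tangent_of_sgn _ _ _ _ d h₂ hd E2
    · exact tangent_of_sgn _ _ _ _ d h₃ hd E3

lemma cm_inj (x₁ x₂ x₃ : Pl) (r₁ r₂ r₃ : ℝ)
    (h₁ : 0 < r₁) (h₂ : 0 < r₂)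
    (h₁₂ : dist x₁ x₂ > r₁ + r₂) :
    Set.InjOn (cm x₁ r₁) (TX x₁ x₂ x₃ r₁ r₂ r₃ ∩ {t | t.2.2.2 ≠ 0}) := by
  rintro ⟨d, u, v, w⟩ ⟨ht, hw⟩ ⟨d', u', v', w'⟩ ⟨ht', hw'⟩ heq
  simp only [Set.mem_ofPred_eq] at hw hw'
  obtain ⟨E1, E2, E3⟩ := circ_eqs _ _ _ _ _ _ _ _ _ _ ht hw
  obtain ⟨E1', E2', E3'⟩ := circ_eqs _ _ _ _ _ _ _ _ _ _ ht' hw'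
  have hd := ht.1
  have hd' := ht'.1
  simp only at hd hd'
  unfold cm at heq
  simp only [Prod.mk.injEq] at heq
  obtain ⟨hy, hs⟩ := heq
  have y0 := congrArg (fun v : Pl => v 0) hy
  have y1 := congrArg (fun v : Pl => v 1) hy
  simp only [PiLp.toLp_apply, Matrix.cons_val_zero, Matrix.cons_val_one] at y0 y1
  have hne := sig_ne x₁ x₂ (!₂[x₁ 0 + u / w, x₁ 1 + v / w]) r₁ r₂ d (r₁ + 1 / w) h₁ h₂ hd h₁₂
    (by simpa using E1) (by simpa using E2)
  rw [← y0, ← y1] at E1' E2'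
  have hσ : r₁ + 1 / w = r₁ + 1 / w' := by
    rcases abs_eq_abs.1 hs with h | h
    · exact h
    · exfalso
      have h' : r₁ + 1 / w' = - (r₁ + 1 / w) := by linarith
      rw [h'] at E1'
      have : (r₁ + 1 / w) * r₁ = 0 := by linarith
      exact mul_ne_zero hne h₁.ne' this
  have hww : w = w' := by
    have : 1 / w = 1 / w' := by linarith
    simpa using this
  subst hww
  have hu : u = u' := by
    have : u / w = u' / w := by linarith
    field_simp at this; exact this
  have hv : v = v' := by
    have : v / w = v' / w := by linarith
    field_simp at this; exact this
  have hdd : d = d' := sgn_unique hne h₂ (E2.symm.trans E2') hd hd'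
  rw [hu, hv, hdd]

lemma lines_eq (x₁ x₂ x₃ : Pl) (r₁ r₂ r₃ : ℝ)
    (h₁ : 0 < r₁) (h₂ : 0 < r₂) (h₃ : 0 < r₃)
    (h₂₃ : dist x₂ x₃ < r₂ + r₃) :
    {L : AffineSubspace ℝ Pl | Module.finrank ℝ L.direction = 1 ∧
      ∀ i, LineTangent L (![x₁, x₂, x₃] i) (![r₁, r₂, r₃] i)} =
    lm x₁ r₁ '' (TX x₁ x₂ x₃ r₁ r₂ r₃ ∩ {t | t.2.2.2 = 0}) := by
  ext L
  simp only [Set.mem_ofPred_eq, Fin.forall_fin_succ, Set.mem_image, Set.mem_inter_iff]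
  constructor
  · rintro ⟨hL, t1, t2, t3, -⟩
    simp at t1 t2 t3
    obtain ⟨u, v, huv, rfl⟩ := line_form L hL x₁ r₁ h₁ t1
    rw [ln_tangent _ _ _ huv _ _ h₂] at t2
    rw [ln_tangent _ _ _ huv _ _ h₃] at t3
    have key : ¬ ((u * (x₂ 0 - x₃ 0) + v * (x₂ 1 - x₃ 1)) ^ 2 = (r₂ + r₃) ^ 2) := by
      intro h
      have D := dist_sq_coord x₂ x₃
      have : dist x₂ x₃ ^ 2 < (r₂ + r₃) ^ 2 :=
        pow_lt_pow_left₀ h₂₃ dist_nonneg (by norm_num)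
      have cs : (u * (x₂ 0 - x₃ 0) + v * (x₂ 1 - x₃ 1)) ^ 2 ≤ dist x₂ x₃ ^ 2 := by
        rw [D]
        have : (x₂ 0 - x₃ 0) ^ 2 + (x₂ 1 - x₃ 1) ^ 2 -
          (u * (x₂ 0 - x₃ 0) + v * (x₂ 1 - x₃ 1)) ^ 2 =
          (u * (x₂ 1 - x₃ 1) - v * (x₂ 0 - x₃ 0)) ^ 2 := by
          linear_combination (-((x₂ 0 - x₃ 0) ^ 2 + (x₂ 1 - x₃ 1) ^ 2)) * huv
        nlinarith [sq_nonneg (u * (x₂ 1 - x₃ 1) - v * (x₂ 0 - x₃ 0))]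
      linarith
    obtain ⟨d, hd, f2, f3⟩ : ∃ d : ℝ, (d = 1 ∨ d = -1) ∧
        u * x₂ 0 + v * x₂ 1 - (u * x₁ 0 + v * x₁ 1 - r₁) = d * r₂ ∧
        u * x₃ 0 + v * x₃ 1 - (u * x₁ 0 + v * x₁ 1 - r₁) = d * r₃ := by
      rcases sq_eq_sq_iff_eq_or_eq_neg.1 t2 with k2 | k2 <;>
      rcases sq_eq_sq_iff_eq_or_eq_neg.1 t3 with k3 | k3
      · exact ⟨1, Or.inl rfl, by linarith, by linarith⟩
      · refine (key ?_).elim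
        have : u * (x₂ 0 - x₃ 0) + v * (x₂ 1 - x₃ 1) = r₂ + r₃ := by linarith
        rw [this]
      · refine (key ?_).elim
        have : u * (x₂ 0 - x₃ 0) + v * (x₂ 1 - x₃ 1) = -(r₂ + r₃) := by linarith
        rw [this]; ring
      · exact ⟨-1, Or.inr rfl, by linarith, by linarith⟩
    refine ⟨(d, u, v, 0), ⟨⟨hd, huv, ?_, ?_⟩, rfl⟩, rfl⟩
    · simp only; linear_combination 2 * f2
    · simp only; linear_combination 2 * f3
  · rintro ⟨⟨d, u, v, w⟩, ⟨⟨hd, huv, ha, hb⟩, hw⟩, rfl⟩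
    simp only at hd huv ha hb hw
    subst hw
    have dsq : d ^ 2 = 1 := by rcases hd with rfl | rfl <;> norm_num
    refine ⟨finrank_ln _ _ _ huv, ?_, ?_, ?_, fun i => i.elim0⟩
    · refine (ln_tangent _ _ _ huv _ _ h₁).2 ?_
      simp
    · refine (ln_tangent _ _ _ huv _ _ h₂).2 ?_
      simp
      have : u * x₂ 0 + v * x₂ 1 - (u * x₁ 0 + v * x₁ 1 - r₁) = d * r₂ := by linarith
      rw [this, mul_pow, dsq, one_mul]
    · refine (ln_tangent _ _ _ huv _ _ h₃).2 ?_
      simp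
      have : u * x₃ 0 + v * x₃ 1 - (u * x₁ 0 + v * x₁ 1 - r₁) = d * r₃ := by linarith
      rw [this, mul_pow, dsq, one_mul]

lemma lm_inj (x₁ x₂ x₃ : Pl) (r₁ r₂ r₃ : ℝ) (h₁ : 0 < r₁) (h₂ : 0 < r₂) :
    Set.InjOn (lm x₁ r₁) (TX x₁ x₂ x₃ r₁ r₂ r₃ ∩ {t | t.2.2.2 = 0}) := by
  rintro ⟨d, u, v, w⟩ ⟨⟨hd, huv, ha, hb⟩, hw⟩ ⟨d', u', v', w'⟩ ⟨⟨hd', huv', ha', hb'⟩, hw'⟩ heq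
  simp only [Set.mem_ofPred_eq] at hd huv ha hb hw hd' huv' ha' hb' hw'
  subst hw hw'
  obtain ⟨rfl, rfl⟩ := line_inj x₁ r₁ u v u' v' h₁ huv huv' heq
  have : d * r₂ = d' * r₂ := by linarith
  rw [mul_right_cancel₀ h₂.ne' this]

/-- If `C₂` and `C₃` cross in two points while `C₁` is externally disjoint from both,
the Apollonius problem has exactly 4 solutions. -/
theorem apollonius_one_crossing_four_solutions (x₁ x₂ x₃ : Pl) (r₁ r₂ r₃ : ℝ)
    (h₁ : 0 < r₁) (h₂ : 0 < r₂) (h₃ : 0 < r₃)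
    (h₂₃ : |r₂ - r₃| < ‖x₂ - x₃‖ ∧ ‖x₂ - x₃‖ < r₂ + r₃)
    (h₁₂ : ‖x₁ - x₂‖ > r₁ + r₂) (h₁₃ : ‖x₁ - x₃‖ > r₁ + r₃) :
    Nat.card (ApolloniusSolutions ![x₁, x₂, x₃] ![r₁, r₂, r₃]) = 4 := by
  rw [← dist_eq_norm] at h₂₃ h₁₂ h₁₃
  obtain ⟨h₂₃, h₂₃'⟩ := h₂₃
  have hT : (TX x₁ x₂ x₃ r₁ r₂ r₃).ncard = 4 := by
    apply TS_card _ _ _ _ _ _ _ h₁ h₂ h₃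
    · have := pow_lt_pow_left₀ h₁₂ (by positivity) (two_ne_zero)
      rw [dist_sq_coord] at this
      linarith
    · have := pow_lt_pow_left₀ h₁₃ (by positivity) (two_ne_zero)
      rw [dist_sq_coord] at this
      linarith
    · have := pow_lt_pow_left₀ h₂₃ (by positivity) (two_ne_zero)
      rw [dist_sq_coord, sq_abs] at this
      linarith
  have hfin : (TX x₁ x₂ x₃ r₁ r₂ r₃).Finite := Set.finite_of_ncard_ne_zero (by rw [hT]; norm_num)
  have hC := circles_eq x₁ x₂ x₃ r₁ r₂ r₃ h₁ h₂ h₃ h₂₃' h₁₂ h₁₃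
  have hL := lines_eq x₁ x₂ x₃ r₁ r₂ r₃ h₁ h₂ h₃ h₂₃'
  have nC := Set.ncard_image_of_injOn (cm_inj x₁ x₂ x₃ r₁ r₂ r₃ h₁ h₂ h₁₂)
  have nL := Set.ncard_image_of_injOn (lm_inj x₁ x₂ x₃ r₁ r₂ r₃ h₁ h₂)
  have fC := (hfin.inter_of_left {t | t.2.2.2 ≠ 0}).image (cm x₁ r₁)
  have fL := (hfin.inter_of_left {t | t.2.2.2 = 0}).image (lm x₁ r₁)
  rw [← hC] at nC fC
  rw [← hL] at nL fL
  have hsum : (TX x₁ x₂ x₃ r₁ r₂ r₃ ∩ {t | t.2.2.2 = 0}).ncard +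
      (TX x₁ x₂ x₃ r₁ r₂ r₃ ∩ {t | t.2.2.2 ≠ 0}).ncard = 4 := by
    rw [← hT]
    exact Set.ncard_inter_add_ncard_diff_eq_ncard _ {t : ℝ × ℝ × ℝ × ℝ | t.2.2.2 = 0} hfin
  have eP : IsEmpty {p : Pl // ∀ i, p ∈ K (![x₁, x₂, x₃] i) (![r₁, r₂, r₃] i)} := by
    refine ⟨fun ⟨p, hp⟩ => ?_⟩
    have p1 : dist p x₁ = r₁ := hp 0
    have p2 : dist p x₂ = r₂ := hp 1
    have := dist_triangle x₁ p x₂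
    rw [dist_comm x₁ p] at this
    linarith
  have i1 : Finite {ys : Pl × ℝ // 0 < ys.2 ∧
    ∀ i, CircleTangent ys.1 ys.2 (![x₁, x₂, x₃] i) (![r₁, r₂, r₃] i)} := fC.to_subtype
  have i2 : Finite {L : AffineSubspace ℝ Pl // Module.finrank ℝ L.direction = 1 ∧
    ∀ i, LineTangent L (![x₁, x₂, x₃] i) (![r₁, r₂, r₃] i)} := fL.to_subtype
  have c1 : Nat.card {ys : Pl × ℝ // 0 < ys.2 ∧
    ∀ i, CircleTangent ys.1 ys.2 (![x₁, x₂, x₃] i) (![r₁, r₂, r₃] i)} = _ := nC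
  have c2 : Nat.card {L : AffineSubspace ℝ Pl // Module.finrank ℝ L.direction = 1 ∧
    ∀ i, LineTangent L (![x₁, x₂, x₃] i) (![r₁, r₂, r₃] i)} = _ := nL
  unfold ApolloniusSolutions
  rw [Nat.card_sum, Nat.card_sum, c1, c2, Nat.card_of_isEmpty]
  omega
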